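/- Let R be a de Groot continuum with two distinguished points b₁ ≠ b₂, and let X be the quotient space of ℤ × R by the equivalence relation generated by (n+1, b₁) ~ (n, b₂) for all n ∈ ℤ. Then X is a connected, locally compact Hausdorff space, and the map sending each m ∈ ℤ to the self-homeomorphism of X induced by (n, x) ↦ (n+m, x) is a group isomorphism from ℤ onto the group H(X) of all self-homeomorphisms of X. -/

import Mathlib

/-- The group of self-homeomorphisms of a topological space, under composition. -/
instance homeomorphGroup (X : Type*) [TopologicalSpace X] : Group (X ≃ₜ X) where
  mul f g := g.trans f
  one := Homeomorph.refl X
  inv := Homeomorph.symm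
  mul_assoc _ _ _ := Homeomorph.ext fun _ => rfl
  one_mul _ := Homeomorph.ext fun _ => rfl
  mul_one _ := Homeomorph.ext fun _ => rfl
  inv_mul_cancel f := Homeomorph.ext fun x => f.symm_apply_apply x

/-- The relation on `ℤ × R` identifying `(n+1, b₁)` with `(n, b₂)`. -/
def chainRel (R : Type) (b₁ b₂ : R) : ℤ × R → ℤ × R → Prop :=
  fun p q => p.1 = q.1 + 1 ∧ p.2 = b₁ ∧ q.2 = b₂

namespace Chain

open Set Topology

variable {R : Type} {b₁ b₂ : R}

/-- The realised chain of copies of `R`. -/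
abbrev Space (R : Type) (b₁ b₂ : R) : Type := Quot (chainRel R b₁ b₂)

/-- The `n`-th copy of `R` in the chain. -/
def link (b₁ b₂ : R) (n : ℤ) (x : R) : Space R b₁ b₂ := Quot.mk _ (n, x)

theorem link_succ (n : ℤ) : link b₁ b₂ (n + 1) b₁ = link b₁ b₂ n b₂ :=
  Quot.sound ⟨rfl, rfl, rfl⟩

/-- The collapse of all links before the `m`-th to `b₁` and of all links after it to `b₂`. -/
def retract (b₁ b₂ : R) (m : ℤ) : Space R b₁ b₂ → R :=
  Quot.lift (fun p => if p.1 < m then b₁ else if p.1 = m then p.2 else b₂) <| by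
    rintro ⟨k, x⟩ ⟨l, y⟩ ⟨h, hx, hy⟩
    dsimp only at *
    subst hx hy h
    grind

theorem retract_link (m n : ℤ) (x : R) :
    retract b₁ b₂ m (link b₁ b₂ n x) = if n < m then b₁ else if n = m then x else b₂ := rfl

@[simp]
theorem retract_link_self (n : ℤ) (x : R) : retract b₁ b₂ n (link b₁ b₂ n x) = x := by
  simp [retract_link]

theorem retract_link_of_lt {m n : ℤ} (h : n < m) (x : R) :
    retract b₁ b₂ m (link b₁ b₂ n x) = b₁ := by
  simp [retract_link, h]

theorem retract_link_of_gt {m n : ℤ} (h : m < n) (x : R) :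
    retract b₁ b₂ m (link b₁ b₂ n x) = b₂ := by
  simp [retract_link, h.ne', h.le]

theorem exists_link (p : Space R b₁ b₂) : ∃ n x, link b₁ b₂ n x = p := by
  obtain ⟨⟨n, x⟩, rfl⟩ := Quot.exists_rep p
  exact ⟨n, x, rfl⟩

theorem eq_of_link_eq_link_of_lt (hb : b₁ ≠ b₂) {n k : ℤ} (hnk : n < k) {x y : R}
    (h : ∀ m, retract b₁ b₂ m (link b₁ b₂ n x) = retract b₁ b₂ m (link b₁ b₂ k y)) :
    k = n + 1 ∧ x = b₂ ∧ y = b₁ := by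
  have h₁ := h n
  have h₂ := h k
  have h₃ := h (n + 1)
  simp only [retract_link] at h₁ h₂ h₃
  grind

theorem retract_separates (hb : b₁ ≠ b₂) {p q : Space R b₁ b₂}
    (h : ∀ m, retract b₁ b₂ m p = retract b₁ b₂ m q) : p = q := by
  obtain ⟨n, x, rfl⟩ := exists_link p
  obtain ⟨k, y, rfl⟩ := exists_link q
  rcases lt_trichotomy n k with hnk | rfl | hnk
  · obtain ⟨rfl, rfl, rfl⟩ := eq_of_link_eq_link_of_lt hb hnk h
    exact (link_succ n).symm
  · simpa using congrArg (link b₁ b₂ n) (h n)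
  · obtain ⟨rfl, rfl, rfl⟩ := eq_of_link_eq_link_of_lt hb hnk fun m => (h m).symm
    exact link_succ k

theorem link_injective (n : ℤ) : Function.Injective (link b₁ b₂ n) :=
  Function.LeftInverse.injective (retract_link_self n)

theorem eq_link_of_retract_eq {m : ℤ} {p : Space R b₁ b₂} {x : R}
    (h : retract b₁ b₂ m p = x) (h₁ : x ≠ b₁) (h₂ : x ≠ b₂) : p = link b₁ b₂ m x := by
  obtain ⟨n, y, rfl⟩ := exists_link p
  rw [retract_link] at h
  grind

theorem succ_of_link_eq (hb : b₁ ≠ b₂) {n k : ℤ} (h : link b₁ b₂ n b₂ = link b₁ b₂ k b₁) :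
    k = n + 1 := by
  rcases lt_trichotomy n k with hnk | rfl | hnk
  · exact (eq_of_link_eq_link_of_lt hb hnk fun m => by rw [h]).1
  · exact absurd (link_injective _ h).symm hb
  · exact absurd (eq_of_link_eq_link_of_lt hb hnk fun m => by rw [h]).2.1 hb

theorem eq_of_link_left_eq (hb : b₁ ≠ b₂) {n k : ℤ} (h : link b₁ b₂ n b₁ = link b₁ b₂ k b₁) :
    n = k := by
  have := succ_of_link_eq (n := n - 1) (k := k) hb (by rw [← link_succ, ← h]; congr 1; ring)
  omega

/-- The self-map of the chain moving every link by `m` places. -/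
def shiftFun (b₁ b₂ : R) (m : ℤ) : Space R b₁ b₂ → Space R b₁ b₂ :=
  Quot.map (fun p => (p.1 + m, p.2)) fun p q h => ⟨by dsimp only; rw [h.1]; ring, h.2⟩

theorem shiftFun_link (m n : ℤ) (x : R) :
    shiftFun b₁ b₂ m (link b₁ b₂ n x) = link b₁ b₂ (n + m) x := rfl

theorem shiftFun_shiftFun (m k : ℤ) (p : Space R b₁ b₂) :
    shiftFun b₁ b₂ m (shiftFun b₁ b₂ k p) = shiftFun b₁ b₂ (m + k) p := by
  obtain ⟨n, x, rfl⟩ := exists_link p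
  simp only [shiftFun_link]
  congr 1
  ring

theorem shiftFun_zero (p : Space R b₁ b₂) : shiftFun b₁ b₂ 0 p = p := by
  obtain ⟨n, x, rfl⟩ := exists_link p
  rw [shiftFun_link, add_zero]

section Topology

variable [TopologicalSpace R]

theorem continuous_link (n : ℤ) : Continuous (link b₁ b₂ n) :=
  continuous_quot_mk.comp (by fun_prop : Continuous fun x : R => (n, x))

theorem continuous_retract (m : ℤ) : Continuous (retract b₁ b₂ m) := by
  refine continuous_quot_lift _ (continuous_prod_of_discrete_left.2 fun k => ?_)
  dsimp only
  split_ifs <;> fun_prop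

theorem t2Space [T2Space R] (hb : b₁ ≠ b₂) : T2Space (Space R b₁ b₂) :=
  T2Space.of_injective_continuous (f := fun p m => retract b₁ b₂ m p)
    (fun _ _ h => retract_separates hb (congrFun h)) (continuous_pi continuous_retract)

theorem connectedSpace [ConnectedSpace R] : ConnectedSpace (Space R b₁ b₂) := by
  have h := IsConnected.iUnion_of_chain (s := fun n : ℤ => range (link b₁ b₂ n))
    (fun n => isConnected_range (continuous_link n))
    fun n => ⟨link b₁ b₂ n b₂, ⟨b₂, rfl⟩, ⟨b₁, link_succ n⟩⟩
  rw [connectedSpace_iff_univ]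
  convert h
  refine (eq_univ_of_forall fun p => ?_).symm
  obtain ⟨n, x, rfl⟩ := exists_link p
  exact mem_iUnion.2 ⟨n, x, rfl⟩

theorem weaklyLocallyCompactSpace [T2Space R] [CompactSpace R] (hb : b₁ ≠ b₂) :
    WeaklyLocallyCompactSpace (Space R b₁ b₂) := by
  refine ⟨fun p => ?_⟩
  obtain ⟨n, x, rfl⟩ := exists_link p
  refine ⟨⋃ k ∈ Icc (n - 1) (n + 1), range (link b₁ b₂ k),
    (finite_Icc _ _).isCompact_biUnion fun k _ => isCompact_range (continuous_link k), ?_⟩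
  have hopen : IsOpen ({p | retract b₁ b₂ (n - 1) p ≠ b₁} ∩ {p | retract b₁ b₂ (n + 1) p ≠ b₂}) :=
    (isOpen_compl_singleton.preimage (continuous_retract _)).inter
      (isOpen_compl_singleton.preimage (continuous_retract _))
  refine Filter.mem_of_superset (hopen.mem_nhds ⟨?_, ?_⟩) ?_
  · rw [mem_ofPred_eq, retract_link_of_gt (by omega)]
    exact hb.symm
  · rw [mem_ofPred_eq, retract_link_of_lt (by omega)]
    exact hb
  · rintro q ⟨h₁, h₂⟩
    obtain ⟨k, y, rfl⟩ := exists_link q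
    refine mem_biUnion (x := k) ⟨?_, ?_⟩ ⟨y, rfl⟩
    · by_contra! hk
      exact h₁ (retract_link_of_lt hk y)
    · by_contra! hk
      exact h₂ (retract_link_of_gt hk y)

theorem continuous_shiftFun (m : ℤ) : Continuous (shiftFun b₁ b₂ m) :=
  continuous_quot_lift _ <| continuous_quot_mk.comp <|
    ((continuous_of_discreteTopology (f := fun k : ℤ => k + m)).comp continuous_fst).prodMk
      continuous_snd

/-- The self-homeomorphism of the chain moving every link by `m` places. -/
def shift (b₁ b₂ : R) (m : ℤ) : Space R b₁ b₂ ≃ₜ Space R b₁ b₂ where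
  toFun := shiftFun b₁ b₂ m
  invFun := shiftFun b₁ b₂ (-m)
  left_inv p := by rw [shiftFun_shiftFun, neg_add_cancel, shiftFun_zero]
  right_inv p := by rw [shiftFun_shiftFun, add_neg_cancel, shiftFun_zero]
  continuous_toFun := continuous_shiftFun m
  continuous_invFun := continuous_shiftFun (-m)

theorem shift_link (m n : ℤ) (x : R) :
    shift b₁ b₂ m (link b₁ b₂ n x) = link b₁ b₂ (n + m) x := rfl

/-- Translation of links, as a homomorphism into the homeomorphism group of the chain. -/
def shiftHom (b₁ b₂ : R) : Multiplicative ℤ →* (Space R b₁ b₂ ≃ₜ Space R b₁ b₂) where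
  toFun m := shift b₁ b₂ m.toAdd
  map_one' := Homeomorph.ext shiftFun_zero
  map_mul' m k := Homeomorph.ext fun p => (shiftFun_shiftFun m.toAdd k.toAdd p).symm

theorem shiftHom_injective (hb : b₁ ≠ b₂) : Function.Injective (shiftHom b₁ b₂) := by
  intro m k h
  have h₀ : link b₁ b₂ (0 + m.toAdd) b₁ = link b₁ b₂ (0 + k.toAdd) b₁ :=
    DFunLike.congr_fun h (link b₁ b₂ 0 b₁)
  simpa using eq_of_link_left_eq hb h₀

variable [T2Space R] [ConnectedSpace R]

/-- If `R` is rigid, every continuous injection of `R` into the chain is one of the links. -/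
theorem exists_eq_link (hrigid : ∀ f : R → R, Continuous f → f = id ∨ ∃ c, f = Function.const R c)
    (hb : b₁ ≠ b₂) {g : R → Space R b₁ b₂} (hg : Continuous g) (hinj : Function.Injective g) :
    ∃ m, g = link b₁ b₂ m := by
  by_cases H : ∃ m, retract b₁ b₂ m ∘ g = id
  · obtain ⟨m, hm⟩ := H
    have : Nontrivial R := ⟨b₁, b₂, hb⟩
    have := t2Space hb
    have hdense : Dense (univ \ {b₁, b₂} : Set R) := dense_univ.sdiff_finite (toFinite _)
    refine ⟨m, hg.ext_on hdense (continuous_link m) fun x hx => ?_⟩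
    simp only [mem_sdiff, mem_univ, true_and, mem_insert_iff, mem_singleton_iff, not_or] at hx
    exact eq_link_of_retract_eq (congrFun hm x) hx.1 hx.2
  · push Not at H
    refine absurd (hinj (retract_separates hb fun m => ?_)) hb
    obtain ⟨c, hc⟩ := (hrigid _ ((continuous_retract m).comp hg)).resolve_left (H m)
    exact (congrFun hc b₁).trans (congrFun hc b₂).symm

theorem shiftHom_surjective
    (hrigid : ∀ f : R → R, Continuous f → f = id ∨ ∃ c, f = Function.const R c)
    (hb : b₁ ≠ b₂) : Function.Surjective (shiftHom b₁ b₂) := by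
  intro h
  choose σ hσ using fun n => exists_eq_link hrigid hb
    (h.continuous.comp (continuous_link n)) (h.injective.comp (link_injective n))
  have hsucc : ∀ n, σ (n + 1) = σ n + 1 := fun n => succ_of_link_eq hb <| by
    rw [← hσ, ← hσ, Function.comp_apply, Function.comp_apply, link_succ]
  have hadd : ∀ n, σ n = n + σ 0 := by
    intro n
    induction n using Int.induction_on with
    | zero => simp
    | succ n ih => rw [hsucc, ih]; ring
    | pred n ih =>
      have := hsucc (-(n : ℤ) - 1)
      rw [sub_add_cancel, ih] at this
      linarith
  refine ⟨Multiplicative.ofAdd (σ 0), Homeomorph.ext fun p => ?_⟩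
  obtain ⟨n, x, rfl⟩ := exists_link p
  change link b₁ b₂ (n + σ 0) x = (h ∘ link b₁ b₂ n) x
  rw [hσ, hadd n]

end Topology

end Chain

/-- Example 2.7(ii): the realisation of the chain `C(ℤ)` via a doubly pointed de
Groot continuum is a connected locally compact Hausdorff space whose full
homeomorphism group is the infinite cyclic group `ℤ`, acting by translation of the
first coordinate. -/
theorem chain_realisation_homeo_group
    (R : Type) [MetricSpace R] [CompactSpace R] [ConnectedSpace R] [Nonempty R]
    (hrigid : ∀ f : R → R, Continuous f → f = id ∨ ∃ c, f = Function.const R c)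
    (b₁ b₂ : R) (hb : b₁ ≠ b₂) :
    ConnectedSpace (Quot (chainRel R b₁ b₂)) ∧
    LocallyCompactSpace (Quot (chainRel R b₁ b₂)) ∧
    T2Space (Quot (chainRel R b₁ b₂)) ∧
    ∃ e : Multiplicative ℤ ≃*
        (Quot (chainRel R b₁ b₂) ≃ₜ Quot (chainRel R b₁ b₂)),
      ∀ (m n : ℤ) (x : R),
        e (Multiplicative.ofAdd m) (Quot.mk (chainRel R b₁ b₂) (n, x)) =
          Quot.mk (chainRel R b₁ b₂) (n + m, x) := by
  have := Chain.t2Space (R := R) hb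
  have := Chain.weaklyLocallyCompactSpace (R := R) hb
  exact ⟨Chain.connectedSpace, inferInstance, inferInstance,
    MulEquiv.ofBijective (Chain.shiftHom b₁ b₂)
      ⟨Chain.shiftHom_injective hb, Chain.shiftHom_surjective hrigid hb⟩,
    fun _ _ _ => rfl⟩
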